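/- |Fh_{fun_7}(15) ∩ S_16| = 23, |Fh_{fun_9}(15) ∩ S_16| = 15, |Fh_{fun_10}(15) ∩ S_16| = 24, |Fh_{fun_11}(15) ∩ S_16| = 21, and |Fh_{fun_12}(15) ∩ S_16| = 17. -/

import Mathlib

open scoped BigOperators

/-- Boolean functions in `n` variables. -/
abbrev BF (n : ℕ) := (Fin n → ZMod 2) → ZMod 2

/-- Hamming distance between two Boolean functions. -/
def hd {n : ℕ} (f g : BF n) : ℕ :=
  (Finset.univ.filter (fun x : Fin n → ZMod 2 => f x ≠ g x)).card

/-- The Reed--Muller code `RM(r,n)`: Boolean functions given by evaluation of a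
multivariate polynomial over `F_2` of total degree at most `r`. -/
def RM (r n : ℕ) : Set (BF n) :=
  {f | ∃ p : MvPolynomial (Fin n) (ZMod 2),
    p.totalDegree ≤ r ∧ ∀ x, f x = MvPolynomial.eval x p}

/-- The `r`-th order nonlinearity of a Boolean function. -/
noncomputable def nl (r : ℕ) {n : ℕ} (f : BF n) : ℕ :=
  sInf {d | ∃ g ∈ RM r n, d = hd f g}

/-- Concatenation `f1 || f2` of two Boolean functions. -/
def concat {n : ℕ} (f1 f2 : BF n) : BF (n + 1) :=
  fun x => (1 + x (Fin.last n)) * f1 (x ∘ Fin.castSucc)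
    + x (Fin.last n) * f2 (x ∘ Fin.castSucc)

/-- A Boolean function is homogeneous quadratic if it is of the form
`∑_{i<j} a_{ij} x_i x_j`. -/
def HomQuad {n : ℕ} (g : BF n) : Prop :=
  ∃ a : Fin n → Fin n → ZMod 2,
    ∀ x, g x = ∑ i : Fin n, ∑ j : Fin n, (if i < j then a i j * x i * x j else 0)

/-- `Fh f r` is the set of homogeneous quadratic functions `g` with `nl(f+g) = r`. -/
def Fh {n : ℕ} (f : BF n) (r : ℕ) : Set (BF n) :=
  {g | HomQuad g ∧ nl 1 (f + g) = r}

/-- `NFh f r = |Fh f r|`. -/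
noncomputable def NFh {n : ℕ} (f : BF n) (r : ℕ) : ℕ := (Fh f r).ncard

/-- The set of 6-variable Boolean functions with nonlinearity 16. -/
def S16 : Set (BF 6) := {f | nl 1 f = 16}

/-- `f1` and `f2` are affine equivalent modulo `RM(r,n)`. -/
def AffEquivMod (r n : ℕ) (f1 f2 : BF n) : Prop :=
  ∃ A : Matrix (Fin n) (Fin n) (ZMod 2), IsUnit A ∧ ∃ b : Fin n → ZMod 2,
    (fun x => f1 x + f2 (A.mulVec x + b)) ∈ RM r n

def fun1 : BF 6 := fun x => x 0*x 1*x 5 + x 0*x 2*x 4 + x 1*x 2*x 3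

def fun2 : BF 6 := fun x => x 0*x 1*x 2*x 3 + x 0*x 1*x 5 + x 0*x 3*x 4 + x 1*x 2*x 4

def fun3 : BF 6 := fun x => x 0*x 1*x 2*x 3 + x 0*x 2*x 4 + x 0*x 3*x 5 + x 1*x 2*x 4
  + x 1*x 2*x 5 + x 1*x 3*x 4

def fun4 : BF 6 := fun x => x 0*x 1*x 2*x 5 + x 0*x 1*x 3*x 4 + x 0*x 2*x 4
  + x 0*x 3*x 4 + x 0*x 3*x 5 + x 1*x 2*x 3

def fun5 : BF 6 := fun x => x 0*x 1*x 2*x 3*x 4 + x 0*x 2*x 4 + x 0*x 3*x 5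
  + x 1*x 2*x 4 + x 1*x 2*x 5 + x 1*x 3*x 4

def fun6 : BF 6 := fun x => x 0*x 1*x 2*x 3*x 4*x 5 + x 0*x 1*x 5 + x 0*x 2*x 4
  + x 1*x 2*x 3

def fun7 : BF 6 := fun x => x 0*x 1*x 2*x 3*x 4*x 5 + x 0*x 1*x 2*x 3 + x 0*x 1*x 5
  + x 0*x 3*x 4 + x 1*x 2*x 4 + x 3*x 4

def fun8 : BF 6 := fun x => x 0*x 1*x 2*x 3*x 4*x 5 + x 0*x 1*x 2*x 3 + x 0*x 2*x 4
  + x 0*x 3*x 5 + x 1*x 2*x 4 + x 1*x 2*x 5 + x 1*x 3*x 4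

def fun9 : BF 6 := fun x => x 0*x 1*x 2*x 3*x 4*x 5 + x 0*x 1*x 2*x 5 + x 0*x 1*x 3*x 4
  + x 0*x 2*x 4 + x 0*x 3*x 4 + x 0*x 3*x 5 + x 1*x 2*x 3 + x 3*x 5

def fun10 : BF 6 := fun x => x 0*x 1*x 2*x 3*x 4*x 5 + x 0*x 1*x 2*x 3 + x 0*x 2*x 3
  + x 0*x 4*x 5 + x 1*x 2*x 3 + x 1*x 2*x 5 + x 1*x 3*x 4 + x 2*x 3 + x 2*x 5 + x 3*x 4

def fun11 : BF 6 := fun x => x 0*x 1*x 2*x 3*x 4*x 5 + x 0*x 1*x 2*x 5 + x 0*x 1*x 3*x 4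
  + x 0*x 2*x 4 + x 0*x 3*x 4 + x 0*x 3*x 5 + x 1*x 2*x 3 + x 1*x 2*x 5 + x 1*x 3*x 4
  + x 2*x 4 + x 3*x 4 + x 3*x 5

def fun12 : BF 6 := fun x => x 0*x 1*x 2*x 3*x 4*x 5 + x 1*x 2*x 3*x 4 + x 0*x 1*x 4*x 5
  + x 0*x 2*x 3*x 5 + x 0*x 1*x 3 + x 0*x 1*x 4 + x 1*x 2*x 4 + x 2*x 3*x 4
  + x 0*x 1*x 5 + x 2*x 3*x 5

def g0 : BF 6 := fun x => x 0*x 1*x 2 + x 0*x 3*x 4 + x 1*x 3*x 5 + x 2*x 4*x 5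
  + x 3*x 4*x 5


section TruthTables

/-- The position of `x` in a truth table; the first coordinate is the most significant bit. -/
def pointIndex : (n : ℕ) → (Fin n → ZMod 2) → ℕ
  | 0, _ => 0
  | n + 1, x => (x 0).val * 2 ^ n + pointIndex n (Fin.tail x)

/-- The Boolean function whose truth table is the binary expansion of `T`. -/
def ofTable {n : ℕ} (T : ℕ) : BF n := fun x => if T.testBit (pointIndex n x) then 1 else 0

/-- Evaluates `n` before passing it on, which keeps kernel reduction from duplicating work. -/
def force {α : Type} (n : ℕ) (F : ℕ → α) : α := Nat.rec (F 0) (fun m _ => F (Nat.succ m)) n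

/-- The number with `2 ^ n` base-`256` digits, all equal to `1`. -/
def allOnes : ℕ → ℕ
  | 0 => 1
  | n + 1 => allOnes n * (1 + 256 ^ 2 ^ n)

/-- The distances from `ofTable T` to all linear functions, as base-`256` digits of one number. -/
def packedDist : ℕ → ℕ → ℕ
  | 0, T => T
  | n + 1, T => force T fun T =>
    packedDist n (T % 2 ^ 2 ^ n) * (256 ^ 2 ^ n + 1) + 2 ^ n * allOnes n * 256 ^ 2 ^ n
      - packedDist n (T / 2 ^ 2 ^ n) * (256 ^ 2 ^ n - 1)

/-- Tests whether all `2 ^ n` base-`256` digits of `V` lie between `l` and `u`. -/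
def digitsBetween (l u : ℕ) : ℕ → ℕ → Bool
  | 0, V => force V fun V => Nat.ble l V && Nat.ble V u
  | n + 1, V => force V fun V =>
    digitsBetween l u n (V % 256 ^ 2 ^ n) && digitsBetween l u n (V / 256 ^ 2 ^ n)

/-- Tests whether the six-variable function with truth table `T` has nonlinearity `m`. -/
def hasNl (m T : ℕ) : Bool :=
  force (packedDist 6 T) fun V =>
    !digitsBetween (m + 1) (63 - m) 6 V && digitsBetween m (64 - m) 6 V

theorem force_eq {α : Type} (n : ℕ) (F : ℕ → α) : force n F = F n := by
  cases n <;> rfl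

theorem pointIndex_lt : ∀ (n : ℕ) (x : Fin n → ZMod 2), pointIndex n x < 2 ^ n
  | 0, _ => by simp [pointIndex]
  | n + 1, x => by
    have h := pointIndex_lt n (Fin.tail x)
    have h0 : (x 0).val < 2 := ZMod.val_lt _
    simp only [pointIndex, pow_succ]
    nlinarith

theorem pointIndex_cons_zero (n : ℕ) (x : Fin n → ZMod 2) :
    pointIndex (n + 1) (Fin.cons 0 x : Fin (n + 1) → ZMod 2) = pointIndex n x := by
  simp [pointIndex]

theorem pointIndex_cons_one (n : ℕ) (x : Fin n → ZMod 2) :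
    pointIndex (n + 1) (Fin.cons 1 x : Fin (n + 1) → ZMod 2) = 2 ^ n + pointIndex n x := by
  simp [pointIndex, ZMod.val_one]

theorem zmod_two_cases (a : ZMod 2) : a = 0 ∨ a = 1 := by
  revert a; decide

theorem exists_pointIndex_eq : ∀ (n k : ℕ), k < 2 ^ n → ∃ x, pointIndex n x = k
  | 0, k, hk => ⟨0, by simp [pointIndex] at *; omega⟩
  | n + 1, k, hk => by
    rw [pow_succ] at hk
    rcases lt_or_ge k (2 ^ n) with h | h
    · obtain ⟨x, hx⟩ := exists_pointIndex_eq n k h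
      exact ⟨_, (pointIndex_cons_zero n x).trans hx⟩
    · obtain ⟨x, hx⟩ := exists_pointIndex_eq n (k - 2 ^ n) (by omega)
      exact ⟨_, (pointIndex_cons_one n x).trans (by omega)⟩

theorem sum_cons {M : Type*} [AddCommMonoid M] {n : ℕ} (F : (Fin (n + 1) → ZMod 2) → M) :
    ∑ x, F x = ∑ x, F (Fin.cons 0 x) + ∑ x, F (Fin.cons 1 x) := by
  rw [← (Fin.consEquiv fun _ : Fin (n + 1) => ZMod 2).sum_comp, Fintype.sum_prod_type]
  exact Fin.sum_univ_two _

theorem forall_cons {n : ℕ} (P : (Fin (n + 1) → ZMod 2) → Prop) :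
    (∀ x, P x) ↔ (∀ x, P (Fin.cons 0 x)) ∧ ∀ x, P (Fin.cons 1 x) := by
  refine ⟨fun h => ⟨fun x => h _, fun x => h _⟩, fun h x => ?_⟩
  rw [← Fin.cons_self_tail x]
  rcases zmod_two_cases (x 0) with h0 | h0 <;> rw [h0]
  exacts [h.1 _, h.2 _]

theorem ofTable_cons_zero {n : ℕ} (T : ℕ) (x : Fin n → ZMod 2) :
    (ofTable T : BF (n + 1)) (Fin.cons 0 x) = (ofTable (T % 2 ^ 2 ^ n) : BF n) x := by
  simp [ofTable, pointIndex_cons_zero, Nat.testBit_mod_two_pow, pointIndex_lt]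

theorem ofTable_cons_one {n : ℕ} (T : ℕ) (x : Fin n → ZMod 2) :
    (ofTable T : BF (n + 1)) (Fin.cons 1 x) = (ofTable (T / 2 ^ 2 ^ n) : BF n) x := by
  simp [ofTable, pointIndex_cons_one, Nat.testBit_div_two_pow, add_comm]

theorem ofTable_xor {n : ℕ} (S T : ℕ) :
    (ofTable (S ^^^ T) : BF n) = ofTable S + ofTable T := by
  funext x
  simp only [ofTable, Nat.testBit_xor, Pi.add_apply]
  cases S.testBit (pointIndex n x) <;> cases T.testBit (pointIndex n x) <;> decide

theorem ofTable_injOn (n : ℕ) :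
    Set.InjOn (ofTable : ℕ → BF n) {T | T < 2 ^ 2 ^ n} := by
  intro S hS T hT h
  refine Nat.eq_of_testBit_eq fun k => ?_
  rcases lt_or_ge k (2 ^ n) with hk | hk
  · obtain ⟨x, rfl⟩ := exists_pointIndex_eq n k hk
    have := congrFun h x
    simp only [ofTable] at this
    revert this
    cases S.testBit (pointIndex n x) <;> cases T.testBit (pointIndex n x) <;> simp
  · have hle : 2 ^ 2 ^ n ≤ 2 ^ k := Nat.pow_le_pow_right (by norm_num) hk
    rw [Nat.testBit_lt_two_pow (lt_of_lt_of_le hS hle),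
      Nat.testBit_lt_two_pow (lt_of_lt_of_le hT hle)]

/-- The affine Boolean function `x ↦ b ⬝ x + c`. -/
def affineBF {n : ℕ} (b : Fin n → ZMod 2) (c : ZMod 2) : BF n := fun x => ∑ i, b i * x i + c

theorem hd_eq_sum {n : ℕ} (f g : BF n) : hd f g = ∑ x, if f x ≠ g x then 1 else 0 :=
  Finset.card_filter _ _

theorem hd_le {n : ℕ} (f g : BF n) : hd f g ≤ 2 ^ n := by
  refine (Finset.card_le_univ _).trans_eq ?_
  simp [ZMod.card]

theorem hd_affineBF_one_add {n : ℕ} (f : BF n) (b : Fin n → ZMod 2) (c : ZMod 2) :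
    hd f (affineBF b (c + 1)) + hd f (affineBF b c) = 2 ^ n := by
  have h : ∀ x, ((if f x ≠ affineBF b (c + 1) x then 1 else 0) +
      (if f x ≠ affineBF b c x then 1 else 0) : ℕ) = 1 := fun x => by
    have key : ∀ u v : ZMod 2, u ≠ v + 1 ↔ u = v := by decide
    have hx : f x ≠ affineBF b (c + 1) x ↔ f x = affineBF b c x := by
      simp only [affineBF, ← add_assoc, key]
    by_cases h : f x = affineBF b c x
    · rw [if_pos (hx.mpr h), if_neg (not_not.mpr h)]
    · rw [if_neg (hx.not.mpr h), if_pos h]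
  simp only [hd_eq_sum, ← Finset.sum_add_distrib, h]
  simp [ZMod.card]

theorem affineBF_cons_apply_cons {n : ℕ} (b x : Fin n → ZMod 2) (β ξ c : ZMod 2) :
    affineBF (Fin.cons β b : Fin (n + 1) → ZMod 2) c (Fin.cons ξ x) = affineBF b (c + β * ξ) x := by
  simp only [affineBF, Fin.sum_univ_succ, Fin.cons_zero, Fin.cons_succ]
  ring

theorem hd_ofTable_cons {n : ℕ} (T : ℕ) (b : Fin n → ZMod 2) (β c : ZMod 2) :
    hd (ofTable T) (affineBF (Fin.cons β b : Fin (n + 1) → ZMod 2) c) =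
      hd (ofTable (T % 2 ^ 2 ^ n)) (affineBF b c) +
        hd (ofTable (T / 2 ^ 2 ^ n)) (affineBF b (c + β)) := by
  simp only [hd_eq_sum, sum_cons, affineBF_cons_apply_cons, ofTable_cons_zero, ofTable_cons_one,
    mul_zero, add_zero, mul_one]

theorem allOnes_eq_sum : ∀ n : ℕ, allOnes n = ∑ b : Fin n → ZMod 2, 256 ^ pointIndex n b
  | 0 => by simp [allOnes, pointIndex]
  | n + 1 => by
    simp only [sum_cons, allOnes, pointIndex_cons_zero, pointIndex_cons_one, pow_add,
      ← Finset.mul_sum, ← allOnes_eq_sum n]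
    ring

theorem packedDist_eq_sum : ∀ (n T : ℕ), T < 2 ^ 2 ^ n →
    packedDist n T =
      ∑ b : Fin n → ZMod 2, hd (ofTable T) (affineBF b 0) * 256 ^ pointIndex n b
  | 0, T, hT => by
    have hT : T < 2 := by simpa using hT
    interval_cases T <;> simp [packedDist, hd_eq_sum, pointIndex, ofTable, affineBF]
  | n + 1, T, hT => by
    have h0 : T % 2 ^ 2 ^ n < 2 ^ 2 ^ n := Nat.mod_lt _ (by positivity)
    have h1 : T / 2 ^ 2 ^ n < 2 ^ 2 ^ n := by
      apply Nat.div_lt_of_lt_mul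
      rwa [← pow_add, ← two_mul, ← pow_succ']
    have hK : 1 ≤ 256 ^ 2 ^ n := Nat.one_le_pow _ _ (by norm_num)
    simp only [packedDist, force_eq]
    apply Nat.sub_eq_of_eq_add
    rw [packedDist_eq_sum n _ h0, packedDist_eq_sum n _ h1, allOnes_eq_sum, sum_cons]
    simp only [hd_ofTable_cons, pointIndex_cons_zero, pointIndex_cons_one, Finset.sum_mul,
      Finset.mul_sum, ← Finset.sum_add_distrib]
    refine Finset.sum_congr rfl fun b _ => ?_
    have hc := hd_affineBF_one_add (ofTable (T / 2 ^ 2 ^ n)) b 0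
    obtain ⟨K, hK'⟩ : ∃ K, 256 ^ 2 ^ n = K + 1 := ⟨256 ^ 2 ^ n - 1, by omega⟩
    rw [pow_add, hK', add_tsub_cancel_right, add_zero]
    generalize hd (ofTable (T / 2 ^ 2 ^ n)) (affineBF b (0 + 1)) = d₁ at *
    generalize hd (ofTable (T / 2 ^ 2 ^ n)) (affineBF b 0) = d₀ at *
    rw [← hc]
    generalize hd (ofTable (T % _)) _ = d
    ring

theorem sum_digits_lt : ∀ (n : ℕ) (v : (Fin n → ZMod 2) → ℕ), (∀ b, v b < 256) →
    ∑ b, v b * 256 ^ pointIndex n b < 256 ^ 2 ^ n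
  | 0, v, hv => by simpa [pointIndex] using hv _
  | n + 1, v, hv => by
    have h0 := sum_digits_lt n (fun b => v (Fin.cons 0 b)) fun b => hv _
    have h1 := sum_digits_lt n (fun b => v (Fin.cons 1 b)) fun b => hv _
    have hK : 256 ^ 2 ^ (n + 1) = 256 ^ 2 ^ n * 256 ^ 2 ^ n := by
      rw [← pow_add, ← two_mul, ← pow_succ']
    rw [hK]
    simp only [sum_cons, pointIndex_cons_zero, pointIndex_cons_one, pow_add,
      mul_left_comm _ (256 ^ 2 ^ n), ← Finset.mul_sum]
    have := Nat.mul_le_mul_left (256 ^ 2 ^ n) (Nat.succ_le_of_lt h1)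
    rw [Nat.succ_eq_add_one, mul_add_one] at this
    omega

theorem digitsBetween_iff (l u : ℕ) : ∀ (n : ℕ) (v : (Fin n → ZMod 2) → ℕ), (∀ b, v b < 256) →
    (digitsBetween l u n (∑ b, v b * 256 ^ pointIndex n b) = true ↔ ∀ b, l ≤ v b ∧ v b ≤ u)
  | 0, v, hv => by
    simp [digitsBetween, force_eq, pointIndex, Unique.forall_iff]
  | n + 1, v, hv => by
    have h0 := sum_digits_lt n (fun b => v (Fin.cons 0 b)) fun b => hv _
    have hs : ∑ b, v b * 256 ^ pointIndex (n + 1) b =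
        ∑ b, v (Fin.cons 0 b) * 256 ^ pointIndex n b +
          256 ^ 2 ^ n * ∑ b, v (Fin.cons 1 b) * 256 ^ pointIndex n b := by
      simp only [sum_cons, pointIndex_cons_zero, pointIndex_cons_one, pow_add,
        mul_left_comm _ (256 ^ 2 ^ n), ← Finset.mul_sum]
    rw [forall_cons, ← digitsBetween_iff l u n (fun b => v (Fin.cons 0 b)) fun b => hv _,
      ← digitsBetween_iff l u n (fun b => v (Fin.cons 1 b)) fun b => hv _, hs]
    simp only [digitsBetween, force_eq, Bool.and_eq_true]
    rw [Nat.add_mul_mod_self_left, Nat.mod_eq_of_lt h0, Nat.add_mul_div_left _ _ (by positivity),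
      Nat.div_eq_of_lt h0, zero_add]

end TruthTables

section Nonlinearity

theorem affineBF_mem_RM {n : ℕ} (b : Fin n → ZMod 2) (c : ZMod 2) : affineBF b c ∈ RM 1 n := by
  refine ⟨∑ i, MvPolynomial.C (b i) * MvPolynomial.X i + MvPolynomial.C c, ?_, fun x => ?_⟩
  · refine (MvPolynomial.totalDegree_add _ _).trans (max_le ?_ (by simp))
    refine MvPolynomial.totalDegree_finsetSum_le fun i _ => ?_
    refine (MvPolynomial.totalDegree_mul _ _).trans ?_
    simp
  · simp [affineBF]

theorem mem_RM_one_iff {n : ℕ} (f : BF n) : f ∈ RM 1 n ↔ ∃ b c, f = affineBF b c := by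
  constructor
  · rintro ⟨p, hp, hf⟩
    refine ⟨fun i => p.coeff (Finsupp.single i 1), p.coeff 0, funext fun x => ?_⟩
    rw [hf, MvPolynomial.eval_eq']
    have hdeg : ∀ d ∈ p.support, d = 0 ∨ ∃ i, Finsupp.single i 1 = d := by
      intro d hd
      have h1 : d.degree ≤ 1 := (MvPolynomial.le_totalDegree hd).trans hp
      rcases Nat.le_one_iff_eq_zero_or_eq_one.mp h1 with h | h
      · exact Or.inl ((Finsupp.degree_eq_zero_iff d).mp h)
      · obtain ⟨i, hi⟩ : ∃ i, d i ≠ 0 := by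
          by_contra! h0
          simp [show d = 0 from Finsupp.ext h0] at h
        have hle : Finsupp.single i 1 ≤ d := Finsupp.single_le_iff.mpr (by omega)
        have hsum := congrArg Finsupp.degree (tsub_add_cancel_of_le hle)
        rw [map_add, Finsupp.degree_single, h, Nat.add_eq_right, Finsupp.degree_eq_zero_iff] at hsum
        exact Or.inr ⟨i, by simpa [hsum] using tsub_add_cancel_of_le hle⟩
    have hsub : p.support ⊆ Finset.cons 0 (Finset.univ.map
        ⟨fun i => Finsupp.single i 1, Finsupp.single_left_injective one_ne_zero⟩) (by simp) := by
      intro d hd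
      rcases hdeg d hd with rfl | ⟨i, rfl⟩ <;> simp
    rw [Finset.sum_subset hsub fun d _ hd => by simp [MvPolynomial.notMem_support_iff.mp hd],
      Finset.sum_cons, Finset.sum_map]
    have hprod : ∀ i, ∏ j, x j ^ (Finsupp.single i 1 : Fin n →₀ ℕ) j = x i := fun i => by
      simp [Finsupp.single_apply, pow_ite]
    simp [affineBF, hprod, add_comm]
  · rintro ⟨b, c, rfl⟩
    exact affineBF_mem_RM b c

theorem nl_one_eq_iff {n : ℕ} (f : BF n) (m : ℕ) :
    nl 1 f = m ↔ (∀ b c, m ≤ hd f (affineBF b c)) ∧ ∃ b c, hd f (affineBF b c) = m := by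
  have hset : {d | ∃ g ∈ RM 1 n, d = hd f g} = {d | ∃ b c, hd f (affineBF b c) = d} := by
    ext d
    simp only [mem_RM_one_iff, Set.mem_ofPred_eq]
    constructor
    · rintro ⟨_, ⟨b, c, rfl⟩, rfl⟩
      exact ⟨b, c, rfl⟩
    · rintro ⟨b, c, rfl⟩
      exact ⟨_, ⟨b, c, rfl⟩, rfl⟩
  rw [nl, hset]
  constructor
  · rintro rfl
    exact ⟨fun b c => Nat.sInf_le ⟨b, c, rfl⟩,
      Nat.sInf_mem (s := {d | ∃ b c, hd f (affineBF b c) = d}) ⟨_, 0, 0, rfl⟩⟩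
  · rintro ⟨hle, b, c, hbc⟩
    refine le_antisymm (Nat.sInf_le ⟨b, c, hbc⟩) ?_
    refine le_csInf ⟨_, b, c, hbc⟩ ?_
    rintro _ ⟨b', c', rfl⟩
    exact hle b' c'

theorem hasNl_iff {m T : ℕ} (hm : m ≤ 32) (hT : T < 2 ^ 64) :
    hasNl m T = true ↔ nl 1 (ofTable T : BF 6) = m := by
  have hlt : ∀ b : Fin 6 → ZMod 2, hd (ofTable T) (affineBF b 0) < 256 :=
    fun b => (hd_le _ _).trans_lt (by norm_num)
  have hc : ∀ b : Fin 6 → ZMod 2,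
      hd (ofTable T) (affineBF b 1) + hd (ofTable T) (affineBF b 0) = 64 := fun b => by
    simpa using hd_affineBF_one_add (ofTable T) b 0
  have hforall : ∀ P : ZMod 2 → Prop, (∀ c, P c) ↔ P 0 ∧ P 1 := fun P =>
    ⟨fun h => ⟨h 0, h 1⟩, fun h c => by rcases zmod_two_cases c with rfl | rfl; exacts [h.1, h.2]⟩
  have hexists : ∀ P : ZMod 2 → Prop, (∃ c, P c) ↔ P 0 ∨ P 1 := fun P =>
    ⟨fun ⟨c, h⟩ => by rcases zmod_two_cases c with rfl | rfl; exacts [.inl h, .inr h],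
      fun h => h.elim (⟨0, ·⟩) (⟨1, ·⟩)⟩
  rw [hasNl, force_eq, Bool.and_eq_true, Bool.not_eq_true', ← Bool.not_eq_true,
    packedDist_eq_sum 6 T hT, digitsBetween_iff _ _ _ _ hlt, digitsBetween_iff _ _ _ _ hlt,
    nl_one_eq_iff, and_comm]
  simp only [hforall, hexists, not_forall]
  constructor
  · rintro ⟨h, b, hb⟩
    refine ⟨fun b => ?_, b, ?_⟩
    · have := h b; have := hc b; omega
    · have := h b; have := hc b; omega
  · rintro ⟨h, b, hb⟩
    refine ⟨fun b => ?_, b, ?_⟩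
    · have := h b; have := hc b; omega
    · have := h b; have := hc b; omega

end Nonlinearity

section Radical

/-- The sign `(-1) ^ a`. -/
def sign (a : ZMod 2) : ℤ := if a = 0 then 1 else -1

theorem sign_add (a b : ZMod 2) : sign (a + b) = sign a * sign b := by
  revert a b; decide

theorem sign_le_one (a : ZMod 2) : sign a ≤ 1 := by
  revert a; decide

theorem sum_sign_eq_zero {V : Type*} [AddCommGroup V] [Fintype V] {φ : V → ZMod 2}
    (hφ : ∀ x y, φ (x + y) = φ x + φ y) (hne : ¬∀ x, φ x = 0) : ∑ x, sign (φ x) = 0 := by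
  push Not at hne
  obtain ⟨e, he⟩ := hne
  have he1 : φ e = 1 := (zmod_two_cases _).resolve_left he
  have h := Equiv.sum_comp (Equiv.addRight e) fun x => sign (φ x)
  simp only [Equiv.coe_addRight, hφ, he1, sign_add, show sign 1 = -1 from rfl, mul_neg, mul_one,
    Finset.sum_neg_distrib] at h
  omega

theorem sq_sum_sign_le {V : Type*} [AddCommGroup V] [Fintype V] {q : V → ZMod 2}
    {B : V → V → ZMod 2} {k : V → ZMod 2} (hB : ∀ d x y, B d (x + y) = B d x + B d y)
    (hq : ∀ x d, q x + q (x + d) = B d x + k d) :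
    (∑ x, sign (q x)) ^ 2 ≤ Fintype.card V * (Finset.univ.filter fun d => ∀ x, B d x = 0).card := by
  calc
    (∑ x, sign (q x)) ^ 2 = ∑ x, ∑ d, sign (q x + q (x + d)) := by
      rw [sq, Finset.sum_mul]
      refine Finset.sum_congr rfl fun x _ => ?_
      rw [Finset.mul_sum, ← Equiv.sum_comp (Equiv.addLeft x)]
      simp [sign_add]
    _ = ∑ d, (∑ x, sign (B d x)) * sign (k d) := by
      rw [Finset.sum_comm]
      simp only [hq, sign_add, Finset.sum_mul]
    _ ≤ ∑ d, if ∀ x, B d x = 0 then (Fintype.card V : ℤ) else 0 := by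
      refine Finset.sum_le_sum fun d _ => ?_
      split_ifs with h
      · simp only [h, show sign 0 = 1 from rfl, Finset.sum_const, Finset.card_univ, nsmul_eq_mul,
          mul_one]
        nlinarith [sign_le_one (k d)]
      · rw [sum_sign_eq_zero (hB d) h, zero_mul]
    _ = _ := by
      rw [← Finset.sum_filter, Finset.sum_const, nsmul_eq_mul, mul_comm]

theorem sum_sign_add {n : ℕ} (f g : BF n) : ∑ x, sign (f x + g x) = 2 ^ n - 2 * hd f g := by
  have h : ∀ x, sign (f x + g x) = 1 - 2 * ((if f x ≠ g x then 1 else 0 : ℕ) : ℤ) := fun x => by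
    have h0 : ∀ u v : ZMod 2, u + v = 0 ↔ u = v := by decide
    by_cases hx : f x = g x <;> simp [sign, h0, hx]
  simp only [h, hd_eq_sum, Finset.sum_sub_distrib, ← Finset.mul_sum, Nat.cast_sum]
  simp [ZMod.card]

/-- The symmetric coefficient matrix of a homogeneous quadratic function. -/
def symCoeff {n : ℕ} (a : Fin n → Fin n → ZMod 2) (i j : Fin n) : ZMod 2 :=
  if i < j then a i j else if j < i then a j i else 0

/-- The homogeneous quadratic function with coefficients `a`. -/
def quadratic {n : ℕ} (a : Fin n → Fin n → ZMod 2) : BF n :=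
  fun x => ∑ i, ∑ j, if i < j then a i j * x i * x j else 0

theorem quadratic_add {n : ℕ} (a : Fin n → Fin n → ZMod 2) (x d : Fin n → ZMod 2) :
    quadratic a (x + d) =
      quadratic a x + quadratic a d + ∑ i, x i * ∑ j, symCoeff a i j * d j := by
  have hterm : ∀ i j, (if i < j then a i j * (x i + d i) * (x j + d j) else 0) =
      (if i < j then a i j * x i * x j else 0) + (if i < j then a i j * d i * d j else 0) +
        ((if i < j then a i j * x i * d j else 0) + if i < j then a i j * d i * x j else 0) := by
    intro i j
    split_ifs <;> ring
  have hsym : ∀ i j, x i * (symCoeff a i j * d j) =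
      (if i < j then a i j * x i * d j else 0) + if j < i then a j i * d j * x i else 0 := by
    intro i j
    rcases lt_trichotomy i j with h | rfl | h
    · simp [symCoeff, h, h.not_gt]; ring
    · simp [symCoeff]
    · simp [symCoeff, h, h.not_gt]; ring
  simp only [quadratic, Pi.add_apply, hterm, Finset.mul_sum, hsym, Finset.sum_add_distrib]
  congr 2
  exact Finset.sum_comm

theorem sixteen_le_card_radical {a : Fin 6 → Fin 6 → ZMod 2} (h : nl 1 (quadratic a) = 16) :
    16 ≤ (Finset.univ.filter fun d : Fin 6 → ZMod 2 =>
      ∀ x : Fin 6 → ZMod 2, ∑ i, x i * ∑ j, symCoeff a i j * d j = 0).card := by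
  obtain ⟨-, b, c, hbc⟩ := (nl_one_eq_iff _ _).mp h
  have hle := sq_sum_sign_le (q := fun x => quadratic a x + affineBF b c x)
    (B := fun d x => ∑ i, x i * ∑ j, symCoeff a i j * d j)
    (k := fun d => quadratic a d + ∑ i, b i * d i)
    (fun d x y => by simp [add_mul, Finset.sum_add_distrib])
    (fun x d => by
      have h2 : ∀ u : ZMod 2, u + u = 0 := by decide
      simp only [quadratic_add, affineBF, Pi.add_apply, mul_add, Finset.sum_add_distrib]
      linear_combination h2 (quadratic a x) + h2 (∑ i, b i * x i) + h2 c)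
  have hcard : Fintype.card (Fin 6 → ZMod 2) = 64 := by simp [ZMod.card]
  rw [sum_sign_add, hbc, hcard] at hle
  generalize Finset.card _ = r at hle ⊢
  norm_num at hle
  omega

theorem exists_radical_of_nl_eq {a : Fin 6 → Fin 6 → ZMod 2} (h : nl 1 (quadratic a) = 16)
    (p q : Fin 6) :
    ∃ d : Fin 6 → ZMod 2, d ≠ 0 ∧ d p = 0 ∧ d q = 0 ∧ ∀ i, ∑ j, symCoeff a i j * d j = 0 := by
  have hcard := sixteen_le_card_radical h
  obtain ⟨d, hd, e, he, hne, hde⟩ := Finset.exists_ne_map_eq_of_card_lt_of_maps_to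
    (t := Finset.univ) (f := fun d : Fin 6 → ZMod 2 => (d p, d q))
    (lt_of_lt_of_le (by decide) hcard) (fun _ _ => Finset.mem_coe.mpr (Finset.mem_univ _))
  simp only [Finset.mem_filter, Finset.mem_univ, true_and] at hd he
  simp only [Prod.mk.injEq] at hde
  refine ⟨d - e, sub_ne_zero.mpr hne, by simp [hde.1], by simp [hde.2], fun i => ?_⟩
  have hdi := hd (Pi.single i 1)
  have hei := he (Pi.single i 1)
  simp only [Pi.single_apply, ite_mul, one_mul, zero_mul, Finset.sum_ite_eq', Finset.mem_univ,
    if_true] at hdi hei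
  simp [mul_sub, Finset.sum_sub_distrib, hdi, hei]

theorem pfaffian_eq_zero {a b c d e f w x y z : ZMod 2} (hne : ¬(w = 0 ∧ x = 0 ∧ y = 0 ∧ z = 0))
    (h1 : a * x + b * y + c * z = 0) (h2 : a * w + d * y + e * z = 0)
    (h3 : b * w + d * x + f * z = 0) (h4 : c * w + e * x + f * y = 0) :
    a * f + b * e + c * d = 0 := by
  have h2' : (2 : ZMod 2) = 0 := rfl
  by_contra hpf
  have hpf := (zmod_two_cases _).resolve_left hpf
  refine hne ⟨?_, ?_, ?_, ?_⟩
  · linear_combination f * h2 + e * h3 + d * h4 - w * hpf - (e * f * z + d * f * y + d * e * x) * h2'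
  · linear_combination f * h1 + c * h3 + b * h4 - x * hpf - (b * c * w + c * f * z + b * f * y) * h2'
  · linear_combination e * h1 + c * h2 + a * h4 - y * hpf - (a * c * w + c * e * z + a * e * x) * h2'
  · linear_combination d * h1 + b * h2 + a * h3 - z * hpf - (a * b * w + a * d * x + b * d * y) * h2'

theorem symCoeff_comm {n : ℕ} (a : Fin n → Fin n → ZMod 2) (i j : Fin n) :
    symCoeff a i j = symCoeff a j i := by
  rcases lt_trichotomy i j with h | rfl | h
  · simp [symCoeff, h, h.not_gt]
  · rfl
  · simp [symCoeff, h, h.not_gt]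

theorem symCoeff_pfaffian_eq_zero {a : Fin 6 → Fin 6 → ZMod 2} (h : nl 1 (quadratic a) = 16)
    (i j k l p q : Fin 6) (hmem : ∀ m, m = i ∨ m = j ∨ m = k ∨ m = l ∨ m = p ∨ m = q)
    (hsum : ∀ F : Fin 6 → ZMod 2, ∑ m, F m = F i + F j + F k + F l + F p + F q) :
    symCoeff a i j * symCoeff a k l + symCoeff a i k * symCoeff a j l +
      symCoeff a i l * symCoeff a j k = 0 := by
  obtain ⟨d, hne, hp, hq, hd⟩ := exists_radical_of_nl_eq h p q
  have hdiag : ∀ m, symCoeff a m m = 0 := fun m => by simp [symCoeff]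
  have hi := hd i
  have hj := hd j
  have hk := hd k
  have hl := hd l
  rw [hsum, hp, hq] at hi hj hk hl
  simp only [hdiag, zero_mul, mul_zero, zero_add, add_zero, symCoeff_comm a j i,
    symCoeff_comm a k i, symCoeff_comm a l i, symCoeff_comm a k j, symCoeff_comm a l j,
    symCoeff_comm a l k] at hi hj hk hl
  refine pfaffian_eq_zero ?_ hi hj hk hl
  rintro ⟨h1, h2, h3, h4⟩
  refine hne (funext fun m => ?_)
  rcases hmem m with rfl | rfl | rfl | rfl | rfl | rfl <;> assumption

end Radical

section RankTwo

/-- The truth table of the homogeneous quadratic function with the given coefficients. -/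
def quadraticTable (a01 a02 a12 a03 a13 a23 a04 a14 a24 a34 a05 a15 a25 a35 a45 : Bool) : ℕ :=
  (bif a01 then 18446462598732840960 else 0) ^^^
  (bif a02 then 18374966855136706560 else 0) ^^^
  (bif a12 then 18374686483949813760 else 0) ^^^
  (bif a03 then 17361641477096079360 else 0) ^^^
  (bif a13 then 17361376567555522560 else 0) ^^^
  (bif a23 then 17294086455919964160 else 0) ^^^
  (bif a04 then 14757395255531667456 else 0) ^^^
  (bif a14 then 14757170082422194176 else 0) ^^^
  (bif a24 then 14699973487531969536 else 0) ^^^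
  (bif a34 then 13889313184910721216 else 0) ^^^
  (bif a05 then 12297829379609722880 else 0) ^^^
  (bif a15 then 12297641735351828480 else 0) ^^^
  (bif a25 then 12249977906276641280 else 0) ^^^
  (bif a35 then 11574427654092267680 else 0) ^^^
  (bif a45 then 9838263505978427528 else 0)

/-- The Pfaffian of a `4 × 4` alternating matrix over `F_2`. -/
def pfaffian (a b c d e f : Bool) : Bool := ((a && f) ^^ (b && e)) ^^ (c && d)

/-- Concatenates the values of `F` at `false` and `true`. -/
def collect (F : Bool → List ℕ) : List ℕ := F false ++ F true

/-- The empty list if `c` holds, and `l` otherwise. -/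
def prune (c : Bool) (l : List ℕ) : List ℕ := bif c then [] else l

/-- The truth tables of the homogeneous quadratic functions in six variables all of whose
Pfaffians vanish, that is, whose coefficient matrix has rank at most two. -/
def rankTwoTables : List ℕ :=
  collect fun a01 => collect fun a02 => collect fun a12 => collect fun a03 => collect fun a13 =>
  collect fun a23 => prune (pfaffian a01 a02 a03 a12 a13 a23) <| collect fun a04 =>
  collect fun a14 => collect fun a24 => collect fun a34 =>
  prune (pfaffian a01 a02 a04 a12 a14 a24) <| prune (pfaffian a01 a03 a04 a13 a14 a34) <|
  prune (pfaffian a02 a03 a04 a23 a24 a34) <| prune (pfaffian a12 a13 a14 a23 a24 a34) <|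
  collect fun a05 => collect fun a15 => collect fun a25 => collect fun a35 => collect fun a45 =>
  prune (pfaffian a01 a02 a05 a12 a15 a25) <| prune (pfaffian a01 a03 a05 a13 a15 a35) <|
  prune (pfaffian a01 a04 a05 a14 a15 a45) <| prune (pfaffian a02 a03 a05 a23 a25 a35) <|
  prune (pfaffian a02 a04 a05 a24 a25 a45) <| prune (pfaffian a03 a04 a05 a34 a35 a45) <|
  prune (pfaffian a12 a13 a15 a23 a25 a35) <| prune (pfaffian a12 a14 a15 a24 a25 a45) <|
  prune (pfaffian a13 a14 a15 a34 a35 a45) <| prune (pfaffian a23 a24 a25 a34 a35 a45) <|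
  [quadraticTable a01 a02 a12 a03 a13 a23 a04 a14 a24 a34 a05 a15 a25 a35 a45]

theorem mem_collect {T : ℕ} {F : Bool → List ℕ} : T ∈ collect F ↔ ∃ b, T ∈ F b := by
  simp [collect]

theorem mem_prune {T : ℕ} {c : Bool} {l : List ℕ} :
    T ∈ prune c l ↔ c = false ∧ T ∈ l := by
  cases c <;> simp [prune]

/-- The coefficient matrix of a homogeneous quadratic function with values in `Bool`. -/
def boolMatrix (b : Fin 6 → Fin 6 → Bool) : Fin 6 → Fin 6 → ZMod 2 :=
  fun i j => if b i j then 1 else 0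

theorem exists_boolMatrix_eq (a : Fin 6 → Fin 6 → ZMod 2) : ∃ b, boolMatrix b = a := by
  refine ⟨fun i j => decide (a i j = 1), funext fun i => funext fun j => ?_⟩
  rcases zmod_two_cases (a i j) with h | h <;> simp [boolMatrix, h]

theorem ofTable_cond {n : ℕ} (c : Bool) (T : ℕ) (x : Fin n → ZMod 2) :
    (ofTable (bif c then T else 0) : BF n) x = (if c then 1 else 0) * (ofTable T : BF n) x := by
  cases c <;> simp [ofTable]

theorem ofTable_monomial_0_1 : ∀ x, (ofTable 18446462598732840960 : BF 6) x = x 0 * x 1 := by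
  decide +kernel

theorem ofTable_monomial_0_2 : ∀ x, (ofTable 18374966855136706560 : BF 6) x = x 0 * x 2 := by
  decide +kernel

theorem ofTable_monomial_1_2 : ∀ x, (ofTable 18374686483949813760 : BF 6) x = x 1 * x 2 := by
  decide +kernel

theorem ofTable_monomial_0_3 : ∀ x, (ofTable 17361641477096079360 : BF 6) x = x 0 * x 3 := by
  decide +kernel

theorem ofTable_monomial_1_3 : ∀ x, (ofTable 17361376567555522560 : BF 6) x = x 1 * x 3 := by
  decide +kernel

theorem ofTable_monomial_2_3 : ∀ x, (ofTable 17294086455919964160 : BF 6) x = x 2 * x 3 := by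
  decide +kernel

theorem ofTable_monomial_0_4 : ∀ x, (ofTable 14757395255531667456 : BF 6) x = x 0 * x 4 := by
  decide +kernel

theorem ofTable_monomial_1_4 : ∀ x, (ofTable 14757170082422194176 : BF 6) x = x 1 * x 4 := by
  decide +kernel

theorem ofTable_monomial_2_4 : ∀ x, (ofTable 14699973487531969536 : BF 6) x = x 2 * x 4 := by
  decide +kernel

theorem ofTable_monomial_3_4 : ∀ x, (ofTable 13889313184910721216 : BF 6) x = x 3 * x 4 := by
  decide +kernel

theorem ofTable_monomial_0_5 : ∀ x, (ofTable 12297829379609722880 : BF 6) x = x 0 * x 5 := by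
  decide +kernel

theorem ofTable_monomial_1_5 : ∀ x, (ofTable 12297641735351828480 : BF 6) x = x 1 * x 5 := by
  decide +kernel

theorem ofTable_monomial_2_5 : ∀ x, (ofTable 12249977906276641280 : BF 6) x = x 2 * x 5 := by
  decide +kernel

theorem ofTable_monomial_3_5 : ∀ x, (ofTable 11574427654092267680 : BF 6) x = x 3 * x 5 := by
  decide +kernel

theorem ofTable_monomial_4_5 : ∀ x, (ofTable 9838263505978427528 : BF 6) x = x 4 * x 5 := by
  decide +kernel

theorem ofTable_quadraticTable (b : Fin 6 → Fin 6 → Bool) :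
    (ofTable (quadraticTable
        (b 0 1) (b 0 2) (b 1 2) (b 0 3) (b 1 3) (b 2 3) (b 0 4) (b 1 4) (b 2 4) (b 3 4) (b 0 5)
        (b 1 5) (b 2 5) (b 3 5) (b 4 5)) : BF 6) =
      quadratic (boolMatrix b) := by
  funext x
  simp only [quadraticTable, ofTable_xor, Pi.add_apply, ofTable_cond,
    ofTable_monomial_0_1, ofTable_monomial_0_2, ofTable_monomial_1_2, ofTable_monomial_0_3,
    ofTable_monomial_1_3, ofTable_monomial_2_3, ofTable_monomial_0_4, ofTable_monomial_1_4,
    ofTable_monomial_2_4, ofTable_monomial_3_4, ofTable_monomial_0_5, ofTable_monomial_1_5,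
    ofTable_monomial_2_5, ofTable_monomial_3_5, ofTable_monomial_4_5]
  simp [quadratic, boolMatrix, Fin.sum_univ_six]
  ring

theorem quadraticTable_lt (a01 a02 a12 a03 a13 a23 a04 a14 a24 a34 a05 a15 a25 a35 a45 : Bool) :
    quadraticTable a01 a02 a12 a03 a13 a23 a04 a14 a24 a34 a05 a15 a25 a35 a45 < 2 ^ 64 := by
  unfold quadraticTable
  repeat' apply Nat.xor_lt_two_pow
  all_goals rw [Bool.cond_eq_ite]; split_ifs <;> norm_num

theorem pfaffian_eq_false {a b c d e f : Bool}
    (h : (if a then 1 else 0) * (if f then 1 else 0) + (if b then 1 else 0) * (if e then 1 else 0) +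
      (if c then 1 else 0) * (if d then 1 else 0) = (0 : ZMod 2)) :
    pfaffian a b c d e f = false := by
  revert a b c d e f
  decide

theorem pfaffian_boolMatrix_eq_false {b : Fin 6 → Fin 6 → Bool}
    (h : nl 1 (quadratic (boolMatrix b)) = 16) (i j k l p q : Fin 6)
    (hlt : i < j ∧ j < k ∧ k < l)
    (hmem : ∀ m, m = i ∨ m = j ∨ m = k ∨ m = l ∨ m = p ∨ m = q)
    (hsum : ∀ F : Fin 6 → ZMod 2, ∑ m, F m = F i + F j + F k + F l + F p + F q) :
    pfaffian (b i j) (b i k) (b i l) (b j k) (b j l) (b k l) = false := by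
  obtain ⟨hij, hjk, hkl⟩ := hlt
  have := symCoeff_pfaffian_eq_zero h i j k l p q hmem hsum
  simp only [symCoeff, hij, hjk, hkl, hij.trans hjk, hjk.trans hkl, (hij.trans hjk).trans hkl,
    if_true] at this
  exact pfaffian_eq_false this

theorem quadraticTable_mem_rankTwoTables {b : Fin 6 → Fin 6 → Bool}
    (h : nl 1 (quadratic (boolMatrix b)) = 16) :
    quadraticTable
        (b 0 1) (b 0 2) (b 1 2) (b 0 3) (b 1 3) (b 2 3) (b 0 4) (b 1 4) (b 2 4) (b 3 4) (b 0 5)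
        (b 1 5) (b 2 5) (b 3 5) (b 4 5) ∈
      rankTwoTables := by
  have hpf := pfaffian_boolMatrix_eq_false h
  simp only [rankTwoTables, mem_collect, mem_prune, List.mem_singleton]
  refine
    ⟨b 0 1, b 0 2, b 1 2, b 0 3, b 1 3, b 2 3, hpf 0 1 2 3 4 5 ?_ ?_ ?_, b 0 4, b 1 4, b 2 4,
    b 3 4, hpf 0 1 2 4 3 5 ?_ ?_ ?_, hpf 0 1 3 4 2 5 ?_ ?_ ?_, hpf 0 2 3 4 1 5 ?_ ?_ ?_,
    hpf 1 2 3 4 0 5 ?_ ?_ ?_, b 0 5, b 1 5, b 2 5, b 3 5, b 4 5, hpf 0 1 2 5 3 4 ?_ ?_ ?_,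
    hpf 0 1 3 5 2 4 ?_ ?_ ?_, hpf 0 1 4 5 2 3 ?_ ?_ ?_, hpf 0 2 3 5 1 4 ?_ ?_ ?_,
    hpf 0 2 4 5 1 3 ?_ ?_ ?_, hpf 0 3 4 5 1 2 ?_ ?_ ?_, hpf 1 2 3 5 0 4 ?_ ?_ ?_,
    hpf 1 2 4 5 0 3 ?_ ?_ ?_, hpf 1 3 4 5 0 2 ?_ ?_ ?_, hpf 2 3 4 5 0 1 ?_ ?_ ?_, rfl⟩
  all_goals decide

theorem exists_of_mem_rankTwoTables {T : ℕ} (h : T ∈ rankTwoTables) :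
    T < 2 ^ 64 ∧ HomQuad (ofTable T : BF 6) := by
  simp only [rankTwoTables, mem_collect, mem_prune, List.mem_singleton] at h
  obtain ⟨a01, a02, a12, a03, a13, a23, -, a04, a14, a24, a34, -, -, -, -, a05, a15, a25, a35, a45, -,
    -, -, -, -, -, -, -, -, -, rfl⟩ := h
  refine ⟨quadraticTable_lt .., ?_⟩
  let b : Fin 6 → Fin 6 → Bool := ![
    ![false, a01, a02, a03, a04, a05],
    ![false, false, a12, a13, a14, a15],
    ![false, false, false, a23, a24, a25],
    ![false, false, false, false, a34, a35],
    ![false, false, false, false, false, a45],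
    ![false, false, false, false, false, false]]
  exact ⟨boolMatrix b, congrFun (ofTable_quadraticTable b)⟩

/-- The truth tables of the functions in `Fh f 15 ∩ S16`, where `F` is the truth table of `f`. -/
def fhTables (F : ℕ) : List ℕ :=
  rankTwoTables.filter fun T => hasNl 15 (F ^^^ T) && hasNl 16 T

theorem Fh_inter_S16_eq {f : BF 6} {F : ℕ} (hF : F < 2 ^ 64) (hf : ∀ x, ofTable F x = f x) :
    Fh f 15 ∩ S16 = ofTable '' {T | T ∈ fhTables F} := by
  obtain rfl : ofTable F = f := funext hf
  have key : ∀ T, T < 2 ^ 64 → ((hasNl 15 (F ^^^ T) && hasNl 16 T) = true ↔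
      nl 1 (ofTable F + ofTable T : BF 6) = 15 ∧ nl 1 (ofTable T : BF 6) = 16) := fun T hT => by
    rw [Bool.and_eq_true, hasNl_iff (by norm_num) (Nat.xor_lt_two_pow hF hT),
      hasNl_iff (by norm_num) hT, ofTable_xor]
  ext g
  simp only [fhTables, List.mem_filter, Set.mem_image, Set.mem_ofPred_eq, Set.mem_inter_iff]
  constructor
  · rintro ⟨⟨⟨a, ha⟩, h15⟩, h16⟩
    obtain ⟨b, rfl⟩ := exists_boolMatrix_eq a
    obtain rfl : g = quadratic (boolMatrix b) := funext ha
    have h16 : nl 1 (quadratic (boolMatrix b)) = 16 := h16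
    have hT := ofTable_quadraticTable b
    exact ⟨_, ⟨quadraticTable_mem_rankTwoTables h16,
      (key _ (quadraticTable_lt ..)).mpr (by rw [hT]; exact ⟨h15, h16⟩)⟩, hT⟩
  · rintro ⟨T, ⟨hmem, hnl⟩, rfl⟩
    obtain ⟨hlt, hquad⟩ := exists_of_mem_rankTwoTables hmem
    obtain ⟨h15, h16⟩ := (key T hlt).mp hnl
    exact ⟨⟨hquad, h15⟩, h16⟩

theorem ncard_Fh_inter_S16 {f : BF 6} {F : ℕ} {l : List ℕ} (hF : F < 2 ^ 64)
    (hf : ∀ x, ofTable F x = f x) (hl : fhTables F = l) (hnodup : l.Nodup) :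
    (Fh f 15 ∩ S16).ncard = l.length := by
  rw [Fh_inter_S16_eq hF hf, Set.InjOn.ncard_image, hl, ← List.toFinset_card_of_nodup hnodup,
    ← Set.ncard_coe_finset, List.coe_toFinset]
  exact (ofTable_injOn 6).mono fun T hT =>
    (exists_of_mem_rankTwoTables (List.mem_filter.mp hT).1).1

end RankTwo

theorem ofTable_fun7 : ∀ x, ofTable 1633117815089184960 x = fun7 x := by
  decide +kernel

theorem fhTables_fun7 : fhTables 1633117815089184960 = [
    918748342970748096, 868280759244079296, 13838449776997960896, 14757395255531667456,
    868082077088661696, 3472328298653073600, 18229723554184741056, 6172746240701890560,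
    1148417905246863360, 14068119339274076160, 229687085903121600, 14987082341434789056,
    94190070005760,
    3689292523182489600, 18446687778714157056, 217070189962641600, 14974465445494309056,
    18446727516357918720, 18446528828139110400, 12273716360905359360, 3459612446666001600,
    18217007702197669056, 18446556788802846720] := by
  decide +kernel

theorem ofTable_fun9 : ∀ x, ofTable 1585281088960372896 x = fun9 x := by
  decide +kernel

theorem fhTables_fun9 : fhTables 1585281088960372896 = [
    723401730907218080, 5809732168785612960, 5787302131573760160, 11551821695019929760,
    17361641477096079360, 5787213828393574560, 18085043208003297440, 1080880407269928960,
    363108261817241760, 18442521884366008320, 17724749738913321120, 361706384486604960,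
    17723347861582684320, 721988858460262560, 18083630335556341920] := by
  decide +kernel

theorem ofTable_fun10 : ∀ x, ofTable 614990148001635008 x = fun10 x := by
  decide +kernel

theorem fhTables_fun10 : fhTables 614990148001635008 = [
    9838263505978427528, 12297641735351828480, 48037663028718080, 9838150915987769480,
    765787904148114080, 14757170082422194176, 868280759244079296, 9838188445984655496,
    918945484977736896, 17361376567555522560, 6510516212833320960, 4340344141888880640,
    18374686483949813760, 6172746240701890560, 3732358192052305920, 7608268622260469760,
    11067877560957665280, 7595602249063464960, 18012587136938041440, 7392940265878978560,
    17298044694020751360, 6531626837344911360, 4378343266009743360, 18417920380672304640] := by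
  decide +kernel

theorem ofTable_fun11 : ∀ x, ofTable 8070450533164428384 x = fun11 x := by
  decide +kernel

theorem fhTables_fun11 : fhTables 8070450533164428384 = [
    12297829379609722880, 7378697627765833728, 6919323456494372448, 4323521613979991040,
    11551821695019929760, 17361641477096079360, 5787213828393574560, 6510615553911029760,
    4340410369274019840, 3675161597162081280, 18374966855136706560, 1148435428446044160,
    14068333998464040960, 7608384713455042560, 3689517696291962880, 7595767817526312960,
    12273810548100956160, 14714161358815887360, 7393108926671093760, 6531808640536412160,
    11459812802568451680] := by
  decide +kernel

theorem ofTable_fun12 : ∀ x, ofTable 5917378068455907328 x = fun12 x := by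
  decide +kernel

theorem fhTables_fun12 : fhTables 5917378068455907328 = [
    7349986743765984768, 459374171485374048, 17294086455919964160, 6510516212833320960,
    14051445243170012160, 7566162825219970560, 3138493882210759400, 17983147713094547040,
    18417188748405020160, 14699805259686005760, 11935946388931215360, 7595602249063464960,
    8897725361058367560, 71776123339407360, 4378343266009743360, 18227123433382883520,
    4395232023317068800] := by
  decide +kernel

/-- Counting values for `Fh_{fun_i}(15) ∩ S16`, `i ∈ {7,9,10,11,12}`. -/
theorem stmt10 :
    (Fh fun7 15 ∩ S16).ncard = 23 ∧ (Fh fun9 15 ∩ S16).ncard = 15 ∧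
    (Fh fun10 15 ∩ S16).ncard = 24 ∧ (Fh fun11 15 ∩ S16).ncard = 21 ∧
    (Fh fun12 15 ∩ S16).ncard = 17 := by
  exact ⟨ncard_Fh_inter_S16 (by norm_num) ofTable_fun7 fhTables_fun7 (by decide),
    ncard_Fh_inter_S16 (by norm_num) ofTable_fun9 fhTables_fun9 (by decide),
    ncard_Fh_inter_S16 (by norm_num) ofTable_fun10 fhTables_fun10 (by decide),
    ncard_Fh_inter_S16 (by norm_num) ofTable_fun11 fhTables_fun11 (by decide),
    ncard_Fh_inter_S16 (by norm_num) ofTable_fun12 fhTables_fun12 (by decide)⟩
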